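/- arXiv:2209.04033 — 5 statements merged into one kernel-verified Lean document; each statement's English description precedes it below -/
import Mathlib

section
/- Let K be a kernel satisfying the Hörmander condition ∫_{|x| > 2|y|} ‖K(x−y) − K(x)‖ dx ≤ C₂ for every y ∈ ℝⁿ, with C₂ > 0. Let f : ℝⁿ → A be Bochner integrable, supported in the ball B(x₀, R), with ∫_{ℝⁿ} f(y) dy = 0, and assume that for almost every x with |x − x₀| > 2R the integral defining (K∗f)(x) converges. Then ∫_{|x−x₀| > 2R} ‖(K∗f)(x)‖_B dx ≤ C₂ ∫_{ℝⁿ} ‖f(y)‖_A dy. -/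
open MeasureTheory ENNReal

noncomputable section

/-- A weight on `ℝⁿ`: a positive, measurable, locally integrable function. -/
def IsWeight {n : ℕ} (w : EuclideanSpace ℝ (Fin n) → ℝ) : Prop :=
  (∀ x, 0 < w x) ∧ Measurable w ∧ LocallyIntegrable w volume

/-- A kernel: a strongly measurable operator-valued function whose (operator) norm is
locally integrable away from the origin. -/
def IsKernel {n : ℕ} {A B : Type*} [NormedAddCommGroup A] [NormedSpace ℝ A]
    [NormedAddCommGroup B] [NormedSpace ℝ B]
    (K : EuclideanSpace ℝ (Fin n) → (A →L[ℝ] B)) : Prop :=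
  StronglyMeasurable K ∧ LocallyIntegrableOn (fun x => ‖K x‖) ({0}ᶜ) volume

/-- The convolution `(K ∗ f)(x) = ∫ K(x-y)(f(y)) dy`. -/
def kconv {n : ℕ} {A B : Type*} [NormedAddCommGroup A] [NormedSpace ℝ A]
    [NormedAddCommGroup B] [NormedSpace ℝ B]
    (K : EuclideanSpace ℝ (Fin n) → (A →L[ℝ] B)) (f : EuclideanSpace ℝ (Fin n) → A)
    (x : EuclideanSpace ℝ (Fin n)) : B :=
  ∫ y, K (x - y) (f y)

/-- The weighted `L^p` norm `(∫ ‖f‖_B^p w)^{1/p}`, valued in `ℝ≥0∞`. -/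
def wLp {n : ℕ} {B : Type*} [NormedAddCommGroup B]
    (p : ℝ) (w : EuclideanSpace ℝ (Fin n) → ℝ) (f : EuclideanSpace ℝ (Fin n) → B) : ℝ≥0∞ :=
  (∫⁻ x, (‖f x‖₊ : ℝ≥0∞) ^ p * ENNReal.ofReal (w x)) ^ (1 / p)

/-- The weighted `L¹` norm `∫ ‖f‖_B w`, valued in `ℝ≥0∞`. -/
def wL1 {n : ℕ} {B : Type*} [NormedAddCommGroup B]
    (w : EuclideanSpace ℝ (Fin n) → ℝ) (f : EuclideanSpace ℝ (Fin n) → B) : ℝ≥0∞ :=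
  ∫⁻ x, (‖f x‖₊ : ℝ≥0∞) * ENNReal.ofReal (w x)

/-- `w` is a doubling weight with constant `D ≥ 1`. -/
def IsDoubling {n : ℕ} (w : EuclideanSpace ℝ (Fin n) → ℝ) (D : ℝ) : Prop :=
  1 ≤ D ∧ ∀ (x : EuclideanSpace ℝ (Fin n)) (r : ℝ), 0 < r →
    (∫⁻ y in Metric.ball x (2 * r), ENNReal.ofReal (w y))
      ≤ ENNReal.ofReal D * ∫⁻ y in Metric.ball x r, ENNReal.ofReal (w y)

/-- An `A`-valued `w`-(1,q,0)-atom associated with the set `U`: strongly measurable,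
Bochner integrable, supported in `U`, with `‖a‖_{L^q_A(w)} ≤ w(U)^{1/q-1}` and mean zero. -/
def IsAtom1q0 {n : ℕ} {A : Type*} [NormedAddCommGroup A] [NormedSpace ℝ A]
    (w : EuclideanSpace ℝ (Fin n) → ℝ) (q : ℝ) (U : Set (EuclideanSpace ℝ (Fin n)))
    (a : EuclideanSpace ℝ (Fin n) → A) : Prop :=
  StronglyMeasurable a ∧ Integrable a volume ∧ (∀ x ∉ U, a x = 0) ∧
    wLp q w a ≤ ENNReal.ofReal ((∫ x in U, w x) ^ (1 / q - 1)) ∧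
    (∫ x, a x) = 0

/-- Hörmander's integral condition, recentred at `x₀`: the oscillation of `K` is controlled
outside the double of any ball containing `y`. -/
theorem lintegral_enorm_sub_le_of_hormander {n : ℕ} {F : Type*} [NormedAddCommGroup F]
    (K : EuclideanSpace ℝ (Fin n) → F) (C : ℝ≥0∞)
    (hK : ∀ y : EuclideanSpace ℝ (Fin n),
      ∫⁻ x in {x | ‖x‖ > 2 * ‖y‖}, ‖K (x - y) - K x‖ₑ ≤ C)
    (x₀ y : EuclideanSpace ℝ (Fin n)) (R : ℝ) (hy : y ∈ Metric.ball x₀ R) :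
    ∫⁻ x in {x | ‖x - x₀‖ > 2 * R}, ‖K (x - y) - K (x - x₀)‖ₑ ≤ C := by
  have hy' : ‖y - x₀‖ < R := mem_ball_iff_norm.mp hy
  have hpre : {x | ‖x - x₀‖ > 2 * R} = (fun x => x - x₀) ⁻¹' {z | ‖z‖ > 2 * R} := rfl
  calc ∫⁻ x in {x | ‖x - x₀‖ > 2 * R}, ‖K (x - y) - K (x - x₀)‖ₑ
      = ∫⁻ z in {z | ‖z‖ > 2 * R}, ‖K (z - (y - x₀)) - K z‖ₑ := by
        rw [hpre, ← (measurePreserving_sub_right volume x₀).setLIntegral_comp_preimage_emb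
          (MeasurableEquiv.subRight x₀).measurableEmbedding
          (fun z => ‖K (z - (y - x₀)) - K z‖ₑ)]
        simp only [sub_sub_sub_cancel_right]
    _ ≤ ∫⁻ z in {z | ‖z‖ > 2 * ‖y - x₀‖}, ‖K (z - (y - x₀)) - K z‖ₑ :=
        lintegral_mono_set fun z (hz : ‖z‖ > 2 * R) => show ‖z‖ > 2 * ‖y - x₀‖ by linarith
    _ ≤ C := hK _

/-- For `f` of mean zero, the convolution is controlled by the oscillation of the kernel. -/
theorem enorm_kconv_le_lintegral {n : ℕ} {A B : Type*}
    [NormedAddCommGroup A] [NormedSpace ℝ A] [CompleteSpace A]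
    [NormedAddCommGroup B] [NormedSpace ℝ B] [CompleteSpace B]
    (K : EuclideanSpace ℝ (Fin n) → (A →L[ℝ] B)) (f : EuclideanSpace ℝ (Fin n) → A)
    (hf_int : Integrable f volume) (hf_mean : (∫ y, f y) = 0)
    (x x₀ : EuclideanSpace ℝ (Fin n))
    (hx : Integrable (fun y => K (x - y) (f y)) volume) :
    ‖kconv K f x‖ₑ ≤ ∫⁻ y, ‖K (x - y) - K (x - x₀)‖ₑ * ‖f y‖ₑ := by
  have hsub : kconv K f x = ∫ y, (K (x - y) - K (x - x₀)) (f y) := by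
    simp only [sub_apply]
    rw [integral_sub hx ((K (x - x₀)).integrable_comp hf_int),
      (K (x - x₀)).integral_comp_comm hf_int, hf_mean, map_zero, sub_zero, kconv]
  rw [hsub]
  exact (enorm_integral_le_lintegral_enorm _).trans
    (lintegral_mono fun y => ContinuousLinearMap.le_opENorm _ _)

/-- Hörmander's condition for `K`: if `f` is integrable, supported in `B(x₀,R)`, with mean
zero, and `(K∗f)(x)` is defined for a.e. `x` with `|x-x₀| > 2R`, then
`∫_{|x-x₀|>2R} ‖(K∗f)(x)‖ dx ≤ C₂ ∫ ‖f‖`. -/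
theorem hormander_outer_bound {n : ℕ} {A B : Type*}
    [NormedAddCommGroup A] [NormedSpace ℝ A] [CompleteSpace A]
    [NormedAddCommGroup B] [NormedSpace ℝ B] [CompleteSpace B]
    (K : EuclideanSpace ℝ (Fin n) → (A →L[ℝ] B)) (hK : IsKernel K)
    (C₂ : ℝ) (hC₂ : 0 < C₂)
    (hK_horm : ∀ y : EuclideanSpace ℝ (Fin n),
      (∫⁻ x in {x | ‖x‖ > 2 * ‖y‖}, (‖K (x - y) - K x‖₊ : ℝ≥0∞)) ≤ ENNReal.ofReal C₂)
    (x₀ : EuclideanSpace ℝ (Fin n)) (R : ℝ) (hR : 0 < R)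
    (f : EuclideanSpace ℝ (Fin n) → A)
    (hf_int : Integrable f volume)
    (hf_supp : ∀ x ∉ Metric.ball x₀ R, f x = 0)
    (hf_mean : (∫ y, f y) = 0)
    (hconv : ∀ᵐ x ∂volume, ‖x - x₀‖ > 2 * R →
      Integrable (fun y => K (x - y) (f y)) volume) :
    (∫⁻ x in {x | ‖x - x₀‖ > 2 * R}, (‖kconv K f x‖₊ : ℝ≥0∞))
      ≤ ENNReal.ofReal C₂ * ∫⁻ y, (‖f y‖₊ : ℝ≥0∞) := by
  simp only [← enorm_eq_nnnorm] at hK_horm ⊢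
  have hS : MeasurableSet {x : EuclideanSpace ℝ (Fin n) | ‖x - x₀‖ > 2 * R} :=
    measurableSet_lt measurable_const (by fun_prop)
  have hmeas : AEMeasurable
      (Function.uncurry fun x y : EuclideanSpace ℝ (Fin n) =>
        ‖K (x - y) - K (x - x₀)‖ₑ * ‖f y‖ₑ)
      ((volume.restrict {x | ‖x - x₀‖ > 2 * R}).prod volume) := by
    refine AEMeasurable.mul (StronglyMeasurable.enorm ?_).aemeasurable
      hf_int.aestronglyMeasurable.enorm.comp_snd
    exact (hK.1.comp_measurable (measurable_fst.sub measurable_snd)).sub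
      (hK.1.comp_measurable (measurable_fst.sub_const x₀))
  calc ∫⁻ x in {x | ‖x - x₀‖ > 2 * R}, ‖kconv K f x‖ₑ
      ≤ ∫⁻ x in {x | ‖x - x₀‖ > 2 * R}, ∫⁻ y, ‖K (x - y) - K (x - x₀)‖ₑ * ‖f y‖ₑ := by
        refine lintegral_mono_ae ((ae_restrict_iff' hS).2 ?_)
        filter_upwards [hconv] with x hx hxS
        exact enorm_kconv_le_lintegral K f hf_int hf_mean x x₀ (hx hxS)
    _ = ∫⁻ y, ∫⁻ x in {x | ‖x - x₀‖ > 2 * R}, ‖K (x - y) - K (x - x₀)‖ₑ * ‖f y‖ₑ :=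
        lintegral_lintegral_swap hmeas
    _ ≤ ∫⁻ y, ENNReal.ofReal C₂ * ‖f y‖ₑ := by
        refine lintegral_mono fun y => ?_
        by_cases hy : y ∈ Metric.ball x₀ R
        · rw [lintegral_mul_const' _ _ enorm_ne_top]
          gcongr
          exact lintegral_enorm_sub_le_of_hormander K _ hK_horm x₀ y R hy
        · simp [hf_supp y hy]
    _ = ENNReal.ofReal C₂ * ∫⁻ y, ‖f y‖ₑ := lintegral_const_mul' _ _ ofReal_ne_top
end
end

section
/- Let w be a weight, let x₀ ∈ ℝⁿ and R > 0, and let K be a kernel such that ∫_{|x−x₀| ≥ 2|y−x₀|} ‖K(x−y) − K(x−x₀)‖ w(x) dx ≤ C w(y) for every y ≠ x₀, with C > 0. Let f : ℝⁿ → A be Bochner integrable, supported in the ball B(x₀, R), with ∫_{ℝⁿ} f(y) dy = 0 and ∫_{ℝⁿ} ‖f(y)‖_A w(y) dy < ∞, and assume that for almost every x with |x − x₀| > 2R the integral defining (K∗f)(x) converges. Then ∫_{|x−x₀| > 2R} ‖(K∗f)(x)‖_B w(x) dx ≤ C ∫_{ℝⁿ} ‖f(y)‖_A w(y) dy. -/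
open MeasureTheory ENNReal

noncomputable section

/-- Weighted Hörmander estimate: if the kernel `K` satisfies the weighted smoothness
condition centered at `x₀`, and `f` is integrable, supported in `B(x₀,R)`, with mean zero
and `∫ ‖f‖ w < ∞`, and `(K∗f)(x)` is defined for a.e. `x` with `|x-x₀| > 2R`, then
`∫_{|x-x₀|>2R} ‖(K∗f)(x)‖ w(x) dx ≤ C ∫ ‖f(y)‖ w(y) dy`. -/
theorem weighted_hormander_outer_bound {n : ℕ} {A B : Type*}
    [NormedAddCommGroup A] [NormedSpace ℝ A] [CompleteSpace A]
    [NormedAddCommGroup B] [NormedSpace ℝ B] [CompleteSpace B]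
    (w : EuclideanSpace ℝ (Fin n) → ℝ) (hw : IsWeight w)
    (x₀ : EuclideanSpace ℝ (Fin n)) (R : ℝ) (hR : 0 < R)
    (K : EuclideanSpace ℝ (Fin n) → (A →L[ℝ] B)) (hK : IsKernel K)
    (C : ℝ) (hC : 0 < C)
    (hK_smooth : ∀ y : EuclideanSpace ℝ (Fin n), y ≠ x₀ →
      (∫⁻ x in {x | ‖x - x₀‖ ≥ 2 * ‖y - x₀‖},
          (‖K (x - y) - K (x - x₀)‖₊ : ℝ≥0∞) * ENNReal.ofReal (w x))
        ≤ ENNReal.ofReal (C * w y))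
    (f : EuclideanSpace ℝ (Fin n) → A)
    (hf_int : Integrable f volume)
    (hf_supp : ∀ x ∉ Metric.ball x₀ R, f x = 0)
    (hf_mean : (∫ y, f y) = 0)
    (hf_w : (∫⁻ y, (‖f y‖₊ : ℝ≥0∞) * ENNReal.ofReal (w y)) < ⊤)
    (hconv : ∀ᵐ x ∂volume, ‖x - x₀‖ > 2 * R →
      Integrable (fun y => K (x - y) (f y)) volume) :
    (∫⁻ x in {x | ‖x - x₀‖ > 2 * R}, (‖kconv K f x‖₊ : ℝ≥0∞) * ENNReal.ofReal (w x))
      ≤ ENNReal.ofReal C * ∫⁻ y, (‖f y‖₊ : ℝ≥0∞) * ENNReal.ofReal (w y) := by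
  set S : Set (EuclideanSpace ℝ (Fin n)) := {x | ‖x - x₀‖ > 2 * R} with hS
  have hSm : MeasurableSet S :=
    measurableSet_lt measurable_const (measurable_id.sub_const x₀).norm
  have hwm : Measurable fun x => ENNReal.ofReal (w x) := hw.2.1.ennreal_ofReal
  set D : EuclideanSpace ℝ (Fin n) → EuclideanSpace ℝ (Fin n) → ℝ≥0∞ :=
    fun x y => (‖K (x - y) - K (x - x₀)‖₊ : ℝ≥0∞) * ENNReal.ofReal (w x) with hD
  have hDm : Measurable (Function.uncurry D) := by
    have h₁ : StronglyMeasurable fun p : EuclideanSpace ℝ (Fin n) × EuclideanSpace ℝ (Fin n) =>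
        K (p.1 - p.2) := hK.1.comp_measurable (measurable_fst.sub measurable_snd)
    have h₂ : StronglyMeasurable fun p : EuclideanSpace ℝ (Fin n) × EuclideanSpace ℝ (Fin n) =>
        K (p.1 - x₀) := hK.1.comp_measurable (measurable_fst.sub_const x₀)
    exact (h₁.sub h₂).enorm.mul (hwm.comp measurable_fst)
  have hDy : ∀ y, Measurable fun x => D x y := fun y =>
    hDm.of_uncurry_right
  have hDf : AEMeasurable (Function.uncurry fun x y => D x y * (‖f y‖₊ : ℝ≥0∞))
      ((volume.restrict S).prod volume) :=
    hDm.aemeasurable.mul (hf_int.1.comp_snd).enorm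
  have hpoint : ∀ᵐ x ∂volume.restrict S,
      (‖kconv K f x‖₊ : ℝ≥0∞) * ENNReal.ofReal (w x) ≤ ∫⁻ y, D x y * (‖f y‖₊ : ℝ≥0∞) := by
    rw [ae_restrict_iff' hSm]
    filter_upwards [hconv] with x hx hxS
    have hcancel : kconv K f x = ∫ y, (K (x - y) - K (x - x₀)) (f y) := by
      simp_rw [sub_apply]
      rw [integral_sub (hx hxS) ((K (x - x₀)).integrable_comp hf_int),
        (K (x - x₀)).integral_comp_comm hf_int, hf_mean, map_zero, sub_zero, kconv]
    calc (‖kconv K f x‖₊ : ℝ≥0∞) * ENNReal.ofReal (w x)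
        ≤ (∫⁻ y, (‖K (x - y) - K (x - x₀)‖₊ : ℝ≥0∞) * (‖f y‖₊ : ℝ≥0∞))
            * ENNReal.ofReal (w x) := by
          gcongr
          rw [hcancel]
          refine (enorm_integral_le_lintegral_enorm _).trans (lintegral_mono fun y => ?_)
          exact (K (x - y) - K (x - x₀)).le_opENorm (f y)
      _ = ∫⁻ y, D x y * (‖f y‖₊ : ℝ≥0∞) := by
          rw [← lintegral_mul_const' _ _ ofReal_ne_top]
          exact lintegral_congr fun y => mul_right_comm _ _ _
  have hinner : ∀ y, (∫⁻ x in S, D x y * (‖f y‖₊ : ℝ≥0∞))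
      ≤ ENNReal.ofReal C * ((‖f y‖₊ : ℝ≥0∞) * ENNReal.ofReal (w y)) := by
    intro y
    by_cases hy : y ∈ Metric.ball x₀ R
    · by_cases hyx : y = x₀
      · simp [hD, hyx]
      rw [lintegral_mul_const _ (hDy y), mul_comm (‖f y‖₊ : ℝ≥0∞), ← mul_assoc,
        ← ENNReal.ofReal_mul hC.le]
      gcongr
      refine (lintegral_mono_set fun x hx => ?_).trans (hK_smooth y hyx)
      rw [mem_ball_iff_norm] at hy
      simp only [hS, Set.mem_ofPred_eq] at hx ⊢
      linarith
    · simp [hf_supp y hy]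
  calc (∫⁻ x in S, (‖kconv K f x‖₊ : ℝ≥0∞) * ENNReal.ofReal (w x))
      ≤ ∫⁻ x in S, ∫⁻ y, D x y * (‖f y‖₊ : ℝ≥0∞) := lintegral_mono_ae hpoint
    _ = ∫⁻ y, ∫⁻ x in S, D x y * (‖f y‖₊ : ℝ≥0∞) := lintegral_lintegral_swap hDf
    _ ≤ ∫⁻ y, ENNReal.ofReal C * ((‖f y‖₊ : ℝ≥0∞) * ENNReal.ofReal (w y)) :=
        lintegral_mono hinner
    _ = ENNReal.ofReal C * ∫⁻ y, (‖f y‖₊ : ℝ≥0∞) * ENNReal.ofReal (w y) :=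
        lintegral_const_mul' _ _ ofReal_ne_top
end
end

section
/- Let 1 ≤ q < ∞, let w be a weight that is doubling with constant D ≥ 1, and let K be a kernel such that: (i) for every A-valued w-(1,q,0)-atom a, (K∗a)(x) is defined for almost every x and ‖K∗a‖_{L^q_B(w)} ≤ C₁ ‖a‖_{L^q_A(w)}; and (ii) for every x₀ ∈ ℝⁿ and every y ≠ x₀, ∫_{|x−x₀| ≥ 2|y−x₀|} ‖K(x−y) − K(x−x₀)‖ w(x) dx ≤ C₂ w(y). Then every A-valued w-(1,q,0)-atom a satisfies ‖K∗a‖_{L¹_B(w)} ≤ C₁ D + C₂. -/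
open MeasureTheory ENNReal

noncomputable section

/-- Hölder's inequality on a set against the density `v`, with the constant function `1`. -/
lemma setLIntegral_enorm_mul_le {α B : Type*} [MeasurableSpace α] [NormedAddCommGroup B]
    {μ : Measure α} {f : α → B} (hf : StronglyMeasurable f) {v : α → ℝ≥0∞} (hv : Measurable v)
    (S : Set α) {q : ℝ} (hq : 1 ≤ q) :
    ∫⁻ x in S, ‖f x‖ₑ * v x ∂μ ≤
      (∫⁻ x, ‖f x‖ₑ ^ q * v x ∂μ) ^ (1 / q) * (∫⁻ x in S, v x ∂μ) ^ (1 - 1 / q) := by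
  have h := eLpNorm'_le_eLpNorm'_mul_rpow_measure_univ (f := f) (p := 1) (q := q)
    (μ := (μ.restrict S).withDensity v) one_pos hq hf.aestronglyMeasurable
  have hf' : Measurable fun x => ‖f x‖ₑ := hf.enorm
  simp only [eLpNorm', ENNReal.rpow_one, div_one] at h
  rw [lintegral_withDensity_eq_lintegral_mul _ hv hf',
    lintegral_withDensity_eq_lintegral_mul _ hv (hf'.pow_const q),
    withDensity_apply _ MeasurableSet.univ, Measure.restrict_univ] at h
  simp only [Pi.mul_apply, mul_comm (v _)] at h
  refine h.trans ?_
  gcongr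
  exact Measure.restrict_le_self

lemma stronglyMeasurable_kconv_integrand {n : ℕ} {A B : Type*}
    [NormedAddCommGroup A] [NormedSpace ℝ A] [NormedAddCommGroup B] [NormedSpace ℝ B]
    {K : EuclideanSpace ℝ (Fin n) → (A →L[ℝ] B)} (hK : StronglyMeasurable K)
    {a : EuclideanSpace ℝ (Fin n) → A} (ha : StronglyMeasurable a) :
    StronglyMeasurable fun z : EuclideanSpace ℝ (Fin n) × EuclideanSpace ℝ (Fin n) =>
      K (z.1 - z.2) (a z.2) :=
  isBoundedBilinearMap_apply.continuous.comp_stronglyMeasurable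
    ((hK.comp_measurable (measurable_fst.sub measurable_snd)).prodMk
      (ha.comp_measurable measurable_snd))

lemma stronglyMeasurable_kconv {n : ℕ} {A B : Type*}
    [NormedAddCommGroup A] [NormedSpace ℝ A] [NormedAddCommGroup B] [NormedSpace ℝ B]
    {K : EuclideanSpace ℝ (Fin n) → (A →L[ℝ] B)} (hK : StronglyMeasurable K)
    {a : EuclideanSpace ℝ (Fin n) → A} (ha : StronglyMeasurable a) :
    StronglyMeasurable (kconv K a) :=
  (stronglyMeasurable_kconv_integrand hK ha).integral_prod_right'

/-- For `a` of mean zero, one may subtract a constant operator inside the convolution. -/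
lemma enorm_kconv_le {n : ℕ} {A B : Type*}
    [NormedAddCommGroup A] [NormedSpace ℝ A] [CompleteSpace A]
    [NormedAddCommGroup B] [NormedSpace ℝ B] [CompleteSpace B]
    (K : EuclideanSpace ℝ (Fin n) → (A →L[ℝ] B)) {a : EuclideanSpace ℝ (Fin n) → A}
    (ha : Integrable a volume) (ha0 : ∫ x, a x = 0) (T : A →L[ℝ] B)
    (x : EuclideanSpace ℝ (Fin n)) :
    ‖kconv K a x‖ₑ ≤ ∫⁻ y, ‖K (x - y) - T‖ₑ * ‖a y‖ₑ := by
  by_cases hx : Integrable (fun y => K (x - y) (a y)) volume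
  · have h : kconv K a x = ∫ y, (K (x - y) - T) (a y) := by
      simp only [sub_apply]
      rw [integral_sub hx (T.integrable_comp ha), T.integral_comp_comm ha, ha0, map_zero,
        sub_zero, kconv]
    rw [h]
    refine (enorm_integral_le_lintegral_enorm _).trans (lintegral_mono fun y => ?_)
    exact (K (x - y) - T).le_opENorm (a y)
  · simp [kconv, integral_undef hx]

/-- The weighted smoothness condition bounds `K ∗ a` away from the support of `a`. -/
lemma setLIntegral_kconv_compl_ball_le {n : ℕ} {A B : Type*}
    [NormedAddCommGroup A] [NormedSpace ℝ A] [CompleteSpace A]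
    [NormedAddCommGroup B] [NormedSpace ℝ B] [CompleteSpace B]
    {w : EuclideanSpace ℝ (Fin n) → ℝ} (hw : Measurable w)
    {K : EuclideanSpace ℝ (Fin n) → (A →L[ℝ] B)} (hK : StronglyMeasurable K)
    {C : ℝ} (hC : 0 ≤ C)
    (hK_smooth : ∀ (x₀ y : EuclideanSpace ℝ (Fin n)), y ≠ x₀ →
      (∫⁻ x in {x | ‖x - x₀‖ ≥ 2 * ‖y - x₀‖},
          (‖K (x - y) - K (x - x₀)‖₊ : ℝ≥0∞) * ENNReal.ofReal (w x))
        ≤ ENNReal.ofReal (C * w y))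
    (x₀ : EuclideanSpace ℝ (Fin n)) (R : ℝ) {a : EuclideanSpace ℝ (Fin n) → A}
    (ham : StronglyMeasurable a) (hai : Integrable a volume)
    (has : ∀ x ∉ Metric.ball x₀ R, a x = 0) (ha0 : ∫ x, a x = 0) :
    ∫⁻ x in (Metric.ball x₀ (2 * R))ᶜ, ‖kconv K a x‖ₑ * ENNReal.ofReal (w x) ≤
      ENNReal.ofReal C * ∫⁻ y in Metric.ball x₀ R, ‖a y‖ₑ * ENNReal.ofReal (w y) := by
  have hv : Measurable fun x => ENNReal.ofReal (w x) := hw.ennreal_ofReal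
  have hd : Measurable fun z : EuclideanSpace ℝ (Fin n) × EuclideanSpace ℝ (Fin n) =>
      ‖K (z.1 - z.2) - K (z.1 - x₀)‖ₑ :=
    ((hK.comp_measurable (measurable_fst.sub measurable_snd)).sub
      (hK.comp_measurable (measurable_fst.sub_const x₀))).enorm
  have ha : Measurable fun y => ‖a y‖ₑ := ham.enorm
  calc ∫⁻ x in (Metric.ball x₀ (2 * R))ᶜ, ‖kconv K a x‖ₑ * ENNReal.ofReal (w x)
      ≤ ∫⁻ x in (Metric.ball x₀ (2 * R))ᶜ, ∫⁻ y,
          ‖K (x - y) - K (x - x₀)‖ₑ * ‖a y‖ₑ * ENNReal.ofReal (w x) := by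
        refine lintegral_mono fun x => ?_
        rw [lintegral_mul_const' _ _ ENNReal.ofReal_ne_top]
        gcongr
        exact enorm_kconv_le K hai ha0 _ x
    _ = ∫⁻ y, ∫⁻ x in (Metric.ball x₀ (2 * R))ᶜ,
          ‖K (x - y) - K (x - x₀)‖ₑ * ‖a y‖ₑ * ENNReal.ofReal (w x) := by
        refine lintegral_lintegral_swap (Measurable.aemeasurable ?_)
        exact (hd.mul (ha.comp measurable_snd)).mul (hv.comp measurable_fst)
    _ ≤ ∫⁻ y, (Metric.ball x₀ R).indicator
          (fun y => ENNReal.ofReal C * (‖a y‖ₑ * ENNReal.ofReal (w y))) y := by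
        refine lintegral_mono fun y => ?_
        by_cases hy : y ∈ Metric.ball x₀ R
        · rw [Set.indicator_of_mem hy]
          simp only [mul_right_comm _ ‖a y‖ₑ]
          rw [lintegral_mul_const' _ _ enorm_ne_top]
          by_cases hyx : y = x₀
          · have h0 : ‖(0 : A →L[ℝ] B)‖ₑ = 0 := by rw [← ofReal_norm, norm_zero, ofReal_zero]
            simp [hyx, h0]
          calc _ ≤ ENNReal.ofReal (C * w y) * ‖a y‖ₑ := by
                gcongr
                refine (lintegral_mono_set fun x hx => ?_).trans (hK_smooth x₀ y hyx)
                rw [mem_ball_iff_norm] at hy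
                rw [Set.mem_compl_iff, mem_ball_iff_norm, not_lt] at hx
                simp only [Set.mem_ofPred_eq, ge_iff_le]
                linarith
            _ = _ := by rw [ENNReal.ofReal_mul hC]; ring
        · simp [has y hy]
    _ = _ := by
        rw [lintegral_indicator Metric.isOpen_ball.measurableSet,
          lintegral_const_mul' _ _ ENNReal.ofReal_ne_top]

/-- If `w` is doubling with constant `D`, `K` is bounded on atoms in `L^q_B(w)` with
constant `C₁`, and `K` satisfies the weighted smoothness condition with constant `C₂`,
then every `A`-valued `w`-(1,q,0)-atom satisfies `‖K∗a‖_{L¹_B(w)} ≤ C₁ D + C₂`. -/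
theorem atom_L1_bound {n : ℕ} {A B : Type*}
    [NormedAddCommGroup A] [NormedSpace ℝ A] [CompleteSpace A]
    [NormedAddCommGroup B] [NormedSpace ℝ B] [CompleteSpace B]
    (q : ℝ) (hq : 1 ≤ q)
    (w : EuclideanSpace ℝ (Fin n) → ℝ) (hw : IsWeight w)
    (D : ℝ) (hD : IsDoubling w D)
    (K : EuclideanSpace ℝ (Fin n) → (A →L[ℝ] B)) (hK : IsKernel K)
    (C₁ C₂ : ℝ) (hC₁ : 0 < C₁) (hC₂ : 0 < C₂)
    (hKq : ∀ (x₀ : EuclideanSpace ℝ (Fin n)) (R : ℝ) (a : EuclideanSpace ℝ (Fin n) → A),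
      0 < R → IsAtom1q0 w q (Metric.ball x₀ R) a →
        (∀ᵐ x ∂volume, Integrable (fun y => K (x - y) (a y)) volume) ∧
        wLp q w (kconv K a) ≤ ENNReal.ofReal C₁ * wLp q w a)
    (hK_smooth : ∀ (x₀ y : EuclideanSpace ℝ (Fin n)), y ≠ x₀ →
      (∫⁻ x in {x | ‖x - x₀‖ ≥ 2 * ‖y - x₀‖},
          (‖K (x - y) - K (x - x₀)‖₊ : ℝ≥0∞) * ENNReal.ofReal (w x))
        ≤ ENNReal.ofReal (C₂ * w y)) :
    ∀ (x₀ : EuclideanSpace ℝ (Fin n)) (R : ℝ) (a : EuclideanSpace ℝ (Fin n) → A),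
      0 < R → IsAtom1q0 w q (Metric.ball x₀ R) a →
        wL1 w (kconv K a) ≤ ENNReal.ofReal (C₁ * D + C₂) := by
  intro x₀ R a hR hatom
  have hLq := (hKq x₀ R a hR hatom).2
  obtain ⟨ham, hai, has, han, ha0⟩ := hatom
  obtain ⟨hw0, hwm, hwl⟩ := hw
  have hv : Measurable fun x => ENNReal.ofReal (w x) := hwm.ennreal_ofReal
  have hq0 : 0 < q := one_pos.trans_le hq
  have hexp : 0 ≤ 1 - 1 / q := by
    rw [sub_nonneg, div_le_one hq0]; exact hq
  have hexp' : 1 - 1 / q ≤ 1 := by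
    have : 0 ≤ 1 / q := by positivity
    linarith
  set U := Metric.ball x₀ R with hU
  set W : ℝ≥0∞ := ∫⁻ x in U, ENNReal.ofReal (w x) with hW
  have hwU : IntegrableOn w U :=
    (hwl.integrableOn_isCompact (isCompact_closedBall x₀ R)).mono_set Metric.ball_subset_closedBall
  have hWreal : ENNReal.ofReal (∫ x in U, w x) = W :=
    ofReal_integral_eq_lintegral_ofReal hwU (ae_of_all _ fun x => (hw0 x).le)
  have hWtop : W ≠ ∞ := hWreal ▸ ENNReal.ofReal_ne_top
  have hWpos : 0 < W := by
    have hsupp : (Function.support fun x => ENNReal.ofReal (w x)) = Set.univ :=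
      Set.eq_univ_of_forall fun x => (ENNReal.ofReal_pos.2 (hw0 x)).ne'
    rw [hW, setLIntegral_pos_iff hv, hsupp, Set.univ_inter]
    exact Metric.measure_ball_pos volume x₀ hR
  have hWpos' : 0 < ∫ x in U, w x := by
    rwa [← ENNReal.ofReal_pos, hWreal]
  have han' : wLp q w a ≤ W ^ (1 / q - 1) := by
    rwa [← ENNReal.ofReal_rpow_of_pos hWpos', hWreal] at han
  have hcancel : W ^ (1 / q - 1) * W ^ (1 - 1 / q) = 1 := by
    rw [← ENNReal.rpow_add _ _ hWpos.ne' hWtop]; simp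
  have hfar : ∫⁻ x in (Metric.ball x₀ (2 * R))ᶜ, ‖kconv K a x‖ₑ * ENNReal.ofReal (w x)
      ≤ ENNReal.ofReal C₂ := by
    refine (setLIntegral_kconv_compl_ball_le hwm hK.1 hC₂.le hK_smooth x₀ R ham hai has
      ha0).trans ?_
    refine mul_le_of_le_one_right' ?_
    refine (setLIntegral_enorm_mul_le ham hv U hq).trans ?_
    rw [← hcancel]
    gcongr
    exact han'
  have hnear : ∫⁻ x in Metric.ball x₀ (2 * R), ‖kconv K a x‖ₑ * ENNReal.ofReal (w x)
      ≤ ENNReal.ofReal (C₁ * D) := by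
    have hD1 : 1 ≤ ENNReal.ofReal D := by simpa using hD.1
    calc _ ≤ wLp q w (kconv K a) *
          (∫⁻ x in Metric.ball x₀ (2 * R), ENNReal.ofReal (w x)) ^ (1 - 1 / q) :=
        setLIntegral_enorm_mul_le (stronglyMeasurable_kconv hK.1 ham) hv _ hq
      _ ≤ ENNReal.ofReal C₁ * W ^ (1 / q - 1) * (ENNReal.ofReal D * W) ^ (1 - 1 / q) := by
        gcongr
        · exact hLq.trans (by gcongr)
        · exact hD.2 x₀ R hR
      _ = ENNReal.ofReal C₁ * ENNReal.ofReal D ^ (1 - 1 / q) *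
          (W ^ (1 / q - 1) * W ^ (1 - 1 / q)) := by
        rw [ENNReal.mul_rpow_of_nonneg _ _ hexp]; ring
      _ ≤ ENNReal.ofReal C₁ * ENNReal.ofReal D ^ (1 : ℝ) * 1 := by
        rw [hcancel]
        gcongr
      _ = _ := by rw [ENNReal.rpow_one, mul_one, ENNReal.ofReal_mul hC₁.le]
  have hsplit : wL1 w (kconv K a) =
      (∫⁻ x in Metric.ball x₀ (2 * R), ‖kconv K a x‖ₑ * ENNReal.ofReal (w x)) +
        ∫⁻ x in (Metric.ball x₀ (2 * R))ᶜ, ‖kconv K a x‖ₑ * ENNReal.ofReal (w x) :=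
    (lintegral_add_compl _ Metric.isOpen_ball.measurableSet).symm
  rw [hsplit, ENNReal.ofReal_add (mul_nonneg hC₁.le (zero_le_one.trans hD.1)) hC₂.le]
  exact add_le_add hnear hfar
end
end

section
/- Let w be a weight, let c > 1 and C₃ > 0, and let K be a kernel such that ∫_{|x| ≥ c|y|} ‖K(x−y) − K(x)‖ w(x) dx ≤ C₃ w(y) for every y ≠ 0. Let a : ℝⁿ → A be Bochner integrable, supported in the ball B(0, R), with ∫_{ℝⁿ} a(y) dy = 0 and ∫_{ℝⁿ} ‖a(y)‖_A w(y) dy ≤ 1, and assume (K∗a)(x) is defined for almost every x with |x| ≥ cR. Then ∫_{|x| ≥ cR} ‖(K∗a)(x)‖_B w(x) dx ≤ C₃. -/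
open MeasureTheory ENNReal

noncomputable section

/-- Subtracting the constant `K x` inside the convolution of `K` with a mean-zero function bounds
the convolution by the increments of `K`. -/
theorem enorm_kconv_le_lintegral_sub {n : ℕ} {A B : Type*}
    [NormedAddCommGroup A] [NormedSpace ℝ A] [CompleteSpace A]
    [NormedAddCommGroup B] [NormedSpace ℝ B] [CompleteSpace B]
    (K : EuclideanSpace ℝ (Fin n) → (A →L[ℝ] B)) (a : EuclideanSpace ℝ (Fin n) → A)
    (ha_int : Integrable a volume) (ha_mean : (∫ y, a y) = 0)
    (x : EuclideanSpace ℝ (Fin n)) (hx : Integrable (fun y => K (x - y) (a y)) volume) :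
    ‖kconv K a x‖ₑ ≤ ∫⁻ y, ‖K (x - y) - K x‖ₑ * ‖a y‖ₑ := by
  have h : kconv K a x = ∫ y, (K (x - y) - K x) (a y) := by
    simp only [sub_apply]
    rw [integral_sub hx ((K x).integrable_comp ha_int), (K x).integral_comp_comm ha_int,
      ha_mean, map_zero, sub_zero, kconv]
  rw [h]
  exact (enorm_integral_le_lintegral_enorm _).trans
    (lintegral_mono fun y => ContinuousLinearMap.le_opENorm _ _)

/-- Outer estimate for a convolution with a mean-zero function supported in `B(0,R)` with
`∫ ‖a‖ w ≤ 1`, under the weighted smoothness condition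
`∫_{|x| ≥ c|y|} ‖K(x-y) - K(x)‖ w(x) dx ≤ C₃ w(y)` (`y ≠ 0`):
`∫_{|x| ≥ cR} ‖(K∗a)(x)‖ w(x) dx ≤ C₃`. -/
theorem outer_bound_origin {n : ℕ} {A B : Type*}
    [NormedAddCommGroup A] [NormedSpace ℝ A] [CompleteSpace A]
    [NormedAddCommGroup B] [NormedSpace ℝ B] [CompleteSpace B]
    (w : EuclideanSpace ℝ (Fin n) → ℝ) (hw : IsWeight w)
    (c : ℝ) (hc : 1 < c) (C₃ : ℝ) (hC₃ : 0 < C₃)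
    (K : EuclideanSpace ℝ (Fin n) → (A →L[ℝ] B)) (hK : IsKernel K)
    (hK_smooth : ∀ y : EuclideanSpace ℝ (Fin n), y ≠ 0 →
      (∫⁻ x in {x | ‖x‖ ≥ c * ‖y‖},
          (‖K (x - y) - K x‖₊ : ℝ≥0∞) * ENNReal.ofReal (w x))
        ≤ ENNReal.ofReal (C₃ * w y))
    (R : ℝ) (hR : 0 < R)
    (a : EuclideanSpace ℝ (Fin n) → A)
    (ha_int : Integrable a volume)
    (ha_supp : ∀ x ∉ Metric.ball (0 : EuclideanSpace ℝ (Fin n)) R, a x = 0)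
    (ha_mean : (∫ y, a y) = 0)
    (ha_w : (∫⁻ y, (‖a y‖₊ : ℝ≥0∞) * ENNReal.ofReal (w y)) ≤ 1)
    (hconv : ∀ᵐ x ∂volume, ‖x‖ ≥ c * R →
      Integrable (fun y => K (x - y) (a y)) volume) :
    (∫⁻ x in {x | ‖x‖ ≥ c * R}, (‖kconv K a x‖₊ : ℝ≥0∞) * ENNReal.ofReal (w x))
      ≤ ENNReal.ofReal C₃ := by
  have hwm : Measurable fun x => ENNReal.ofReal (w x) := hw.2.1.ennreal_ofReal
  have hS : MeasurableSet {x : EuclideanSpace ℝ (Fin n) | ‖x‖ ≥ c * R} :=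
    measurableSet_le measurable_const measurable_norm
  have hincr : Measurable fun p : EuclideanSpace ℝ (Fin n) × EuclideanSpace ℝ (Fin n) =>
      ‖K (p.1 - p.2) - K p.1‖ₑ :=
    ((hK.1.comp_measurable (measurable_fst.sub measurable_snd)).sub
      (hK.1.comp_measurable measurable_fst)).enorm
  have hmeas : AEMeasurable
      (Function.uncurry fun x y => ‖K (x - y) - K x‖ₑ * ‖a y‖ₑ * ENNReal.ofReal (w x))
      ((volume.restrict {x : EuclideanSpace ℝ (Fin n) | ‖x‖ ≥ c * R}).prod volume) :=
    (hincr.aemeasurable.mul ha_int.1.enorm.comp_snd).mul (hwm.comp measurable_fst).aemeasurable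
  have hpoint : ∀ y, ∫⁻ x in {x | ‖x‖ ≥ c * R},
      ‖K (x - y) - K x‖ₑ * ‖a y‖ₑ * ENNReal.ofReal (w x)
        ≤ ENNReal.ofReal C₃ * (‖a y‖ₑ * ENNReal.ofReal (w y)) := by
    intro y
    rcases eq_or_ne y 0 with rfl | hy
    · have h0 : ∀ x, ‖K (x - 0) - K x‖ₑ = 0 := fun x => by
        rw [sub_zero, sub_self, enorm_eq_nnnorm, nnnorm_zero, ENNReal.coe_zero]
      simp only [h0, zero_mul, lintegral_zero, zero_le]
    by_cases hyR : y ∈ Metric.ball (0 : EuclideanSpace ℝ (Fin n)) R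
    · have hsub : {x : EuclideanSpace ℝ (Fin n) | ‖x‖ ≥ c * R} ⊆ {x | ‖x‖ ≥ c * ‖y‖} := by
        intro x hx
        have hyR' : ‖y‖ ≤ R := (mem_ball_zero_iff.mp hyR).le
        exact (mul_le_mul_of_nonneg_left hyR' (by linarith)).trans hx
      calc ∫⁻ x in {x | ‖x‖ ≥ c * R}, ‖K (x - y) - K x‖ₑ * ‖a y‖ₑ * ENNReal.ofReal (w x)
          = ‖a y‖ₑ * ∫⁻ x in {x | ‖x‖ ≥ c * R},
              ‖K (x - y) - K x‖ₑ * ENNReal.ofReal (w x) := by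
            rw [← lintegral_const_mul' _ _ enorm_ne_top]
            exact lintegral_congr fun x => by ring
        _ ≤ ‖a y‖ₑ * ENNReal.ofReal (C₃ * w y) := by
            gcongr
            exact (lintegral_mono_set hsub).trans (hK_smooth y hy)
        _ = ENNReal.ofReal C₃ * (‖a y‖ₑ * ENNReal.ofReal (w y)) := by
            rw [ENNReal.ofReal_mul hC₃.le]
            ring
    · simp [ha_supp y hyR]
  calc ∫⁻ x in {x | ‖x‖ ≥ c * R}, ‖kconv K a x‖ₑ * ENNReal.ofReal (w x)
      ≤ ∫⁻ x in {x | ‖x‖ ≥ c * R}, ∫⁻ y,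
          ‖K (x - y) - K x‖ₑ * ‖a y‖ₑ * ENNReal.ofReal (w x) := by
        refine lintegral_mono_ae ((ae_restrict_iff' hS).2 ?_)
        filter_upwards [hconv] with x hx hxS
        rw [lintegral_mul_const' _ _ ENNReal.ofReal_ne_top]
        gcongr
        exact enorm_kconv_le_lintegral_sub K a ha_int ha_mean x (hx hxS)
    _ = ∫⁻ y, ∫⁻ x in {x | ‖x‖ ≥ c * R},
          ‖K (x - y) - K x‖ₑ * ‖a y‖ₑ * ENNReal.ofReal (w x) := lintegral_lintegral_swap hmeas
    _ ≤ ∫⁻ y, ENNReal.ofReal C₃ * (‖a y‖ₑ * ENNReal.ofReal (w y)) := lintegral_mono hpoint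
    _ = ENNReal.ofReal C₃ * ∫⁻ y, ‖a y‖ₑ * ENNReal.ofReal (w y) :=
        lintegral_const_mul' _ _ ENNReal.ofReal_ne_top
    _ ≤ ENNReal.ofReal C₃ * 1 := by
        gcongr
        exact ha_w
    _ = ENNReal.ofReal C₃ := mul_one _
end
end

section
/- Let w be a weight that is doubling with constant D ≥ 1, let c > 1, and set k = ⌈log₂ c⌉. Let K be a kernel such that ∫_{|x| ≥ c|y|} ‖K(x−y) − K(x)‖ w(x) dx ≤ C₃ w(y) for every y ≠ 0, with C₃ > 0. Let a be an A-valued w-(1,2,0)-atom associated with a ball B(0, R) centered at the origin, and assume (K∗a)(x) is defined for almost every x and ‖K∗a‖_{L²_B(w)} ≤ C₁ ‖a‖_{L²_A(w)} with C₁ > 0. Then ‖K∗a‖_{L¹_B(w)} ≤ C₁ D^k + C₃. -/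
open MeasureTheory ENNReal

noncomputable section

/-- Cauchy–Schwarz for the weighted norms, localised to a set. -/
lemma setLIntegral_mul_weight_le_wLp_two {n : ℕ} {B : Type*} [NormedAddCommGroup B]
    {w : EuclideanSpace ℝ (Fin n) → ℝ} (hw : Measurable w)
    {f : EuclideanSpace ℝ (Fin n) → B} (hf : StronglyMeasurable f)
    (S : Set (EuclideanSpace ℝ (Fin n))) :
    ∫⁻ x in S, (‖f x‖₊ : ℝ≥0∞) * ENNReal.ofReal (w x)
      ≤ wLp 2 w f * (∫⁻ x in S, ENNReal.ofReal (w x)) ^ (1 / 2 : ℝ) := by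
  have hv : Measurable fun x => ENNReal.ofReal (w x) ^ (1 / 2 : ℝ) :=
    hw.ennreal_ofReal.pow_const _
  have hsq (t : ℝ≥0∞) : (t ^ (1 / 2 : ℝ)) ^ (2 : ℝ) = t := by
    rw [← ENNReal.rpow_mul]; norm_num
  have hmul (t : ℝ≥0∞) : t ^ (1 / 2 : ℝ) * t ^ (1 / 2 : ℝ) = t := by
    rw [← ENNReal.rpow_add_of_nonneg _ _ (by norm_num) (by norm_num)]; norm_num
  have h := ENNReal.lintegral_mul_le_Lp_mul_Lq (volume.restrict S) Real.HolderConjugate.two_two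
    (hf.enorm.mul hv).aemeasurable hv.aemeasurable
  simp only [Pi.mul_apply, mul_assoc, hmul, ENNReal.mul_rpow_of_nonneg _ _ zero_le_two, hsq] at h
  refine h.trans ?_
  gcongr
  exact ENNReal.rpow_le_rpow (setLIntegral_le_lintegral _ _) (by norm_num)

/-- Iterating the doubling condition. -/
lemma IsDoubling.lintegral_ball_two_pow_mul_le {n : ℕ} {w : EuclideanSpace ℝ (Fin n) → ℝ} {D : ℝ}
    (hD : IsDoubling w D) (x : EuclideanSpace ℝ (Fin n)) {r : ℝ} (hr : 0 < r) (k : ℕ) :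
    ∫⁻ y in Metric.ball x (2 ^ k * r), ENNReal.ofReal (w y)
      ≤ ENNReal.ofReal D ^ k * ∫⁻ y in Metric.ball x r, ENNReal.ofReal (w y) := by
  induction k with
  | zero => simp
  | succ k ih =>
    calc ∫⁻ y in Metric.ball x (2 ^ (k + 1) * r), ENNReal.ofReal (w y)
        = ∫⁻ y in Metric.ball x (2 * (2 ^ k * r)), ENNReal.ofReal (w y) := by
          rw [pow_succ', mul_assoc]
      _ ≤ ENNReal.ofReal D * ∫⁻ y in Metric.ball x (2 ^ k * r), ENNReal.ofReal (w y) :=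
          hD.2 x _ (by positivity)
      _ ≤ ENNReal.ofReal D * (ENNReal.ofReal D ^ k *
            ∫⁻ y in Metric.ball x r, ENNReal.ofReal (w y)) := by gcongr
      _ = _ := by rw [pow_succ', mul_assoc]

lemma IsWeight.integrableOn_ball {n : ℕ} {w : EuclideanSpace ℝ (Fin n) → ℝ} (hw : IsWeight w)
    (x : EuclideanSpace ℝ (Fin n)) (r : ℝ) : IntegrableOn w (Metric.ball x r) :=
  (hw.2.2.integrableOn_isCompact (isCompact_closedBall x r)).mono_set Metric.ball_subset_closedBall

lemma IsWeight.ofReal_setIntegral_ball {n : ℕ} {w : EuclideanSpace ℝ (Fin n) → ℝ}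
    (hw : IsWeight w) (x : EuclideanSpace ℝ (Fin n)) (r : ℝ) :
    ENNReal.ofReal (∫ y in Metric.ball x r, w y)
      = ∫⁻ y in Metric.ball x r, ENNReal.ofReal (w y) :=
  ofReal_integral_eq_lintegral_ofReal (hw.integrableOn_ball x r)
    (Filter.Eventually.of_forall fun y => (hw.1 y).le)

lemma IsWeight.setIntegral_ball_pos {n : ℕ} {w : EuclideanSpace ℝ (Fin n) → ℝ}
    (hw : IsWeight w) (x : EuclideanSpace ℝ (Fin n)) {r : ℝ} (hr : 0 < r) :
    0 < ∫ y in Metric.ball x r, w y := by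
  rw [setIntegral_pos_iff_support_of_nonneg_ae
    (Filter.Eventually.of_forall fun y => (hw.1 y).le) (hw.integrableOn_ball x r)]
  have : Function.support w = Set.univ := Set.eq_univ_of_forall fun y => (hw.1 y).ne'
  rw [this, Set.univ_inter]
  exact Metric.measure_ball_pos _ _ hr

/-- The `L²` normalisation of a `w`-(1,2,0)-atom on a ball `U`, as `‖a‖_{2,w} w(U)^{1/2} ≤ 1`. -/
lemma IsAtom1q0.wLp_two_mul_le_one {n : ℕ} {A : Type*} [NormedAddCommGroup A] [NormedSpace ℝ A]
    {w : EuclideanSpace ℝ (Fin n) → ℝ} (hw : IsWeight w) {x : EuclideanSpace ℝ (Fin n)} {r : ℝ}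
    (hr : 0 < r) {a : EuclideanSpace ℝ (Fin n) → A} (ha : IsAtom1q0 w 2 (Metric.ball x r) a) :
    wLp 2 w a * (∫⁻ y in Metric.ball x r, ENNReal.ofReal (w y)) ^ (1 / 2 : ℝ) ≤ 1 := by
  have hpos := hw.setIntegral_ball_pos x hr
  refine (mul_le_mul_left ha.2.2.2.1 _).trans ?_
  rw [← hw.ofReal_setIntegral_ball, ENNReal.ofReal_rpow_of_pos hpos,
    ← ENNReal.ofReal_mul (by positivity), ← Real.rpow_add hpos]
  norm_num

section Convolution

variable {n : ℕ} {A B : Type*} [NormedAddCommGroup A] [NormedSpace ℝ A]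
  [NormedAddCommGroup B] [NormedSpace ℝ B] {K : EuclideanSpace ℝ (Fin n) → (A →L[ℝ] B)}
  {a : EuclideanSpace ℝ (Fin n) → A}

lemma stronglyMeasurable_kconv_s7 (hK : StronglyMeasurable K) (ha : StronglyMeasurable a) :
    StronglyMeasurable (kconv K a) := by
  have h : StronglyMeasurable
      fun p : EuclideanSpace ℝ (Fin n) × EuclideanSpace ℝ (Fin n) => K (p.1 - p.2) (a p.2) :=
    isBoundedBilinearMap_apply.continuous.comp_stronglyMeasurable
      ((hK.comp_measurable (measurable_fst.sub measurable_snd)).prodMk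
        (ha.comp_measurable measurable_snd))
  exact h.integral_prod_right

/-- Against a mean-zero function, the kernel may be replaced by its increments. -/
lemma enorm_kconv_le_of_integral_eq_zero [CompleteSpace A] [CompleteSpace B]
    (ha : Integrable a) (ha0 : ∫ y, a y = 0) {x : EuclideanSpace ℝ (Fin n)}
    (hx : Integrable fun y => K (x - y) (a y)) :
    (‖kconv K a x‖₊ : ℝ≥0∞) ≤ ∫⁻ y, (‖K (x - y) - K x‖₊ : ℝ≥0∞) * ‖a y‖₊ := by
  have h0 : ∫ y, K x (a y) = 0 := by
    rw [ContinuousLinearMap.integral_comp_comm _ ha, ha0, map_zero]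
  have h1 : kconv K a x = ∫ y, (K (x - y) - K x) (a y) := by
    simp only [sub_apply]
    rw [integral_sub hx ((K x).integrable_comp ha), h0, sub_zero, kconv]
  rw [h1]
  refine (enorm_integral_le_lintegral_enorm _).trans (lintegral_mono fun y => ?_)
  exact ContinuousLinearMap.le_opENorm _ _

/-- Far from its support, the convolution of a mean-zero function supported in `B(0,R)` is
controlled by the weighted smoothness condition on the kernel. -/
lemma setLIntegral_compl_ball_kconv_le [CompleteSpace A] [CompleteSpace B]
    {w : EuclideanSpace ℝ (Fin n) → ℝ} (hw : Measurable w)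
    (hK : StronglyMeasurable K) {c C R : ℝ} (hc : 0 ≤ c) (hC : 0 ≤ C)
    (hK_smooth : ∀ y : EuclideanSpace ℝ (Fin n), y ≠ 0 →
      (∫⁻ x in {x | ‖x‖ ≥ c * ‖y‖},
          (‖K (x - y) - K x‖₊ : ℝ≥0∞) * ENNReal.ofReal (w x))
        ≤ ENNReal.ofReal (C * w y))
    (ham : StronglyMeasurable a) (ha : Integrable a) (ha0 : ∫ y, a y = 0)
    (hsupp : ∀ y ∉ Metric.ball (0 : EuclideanSpace ℝ (Fin n)) R, a y = 0)
    (hconv : ∀ᵐ x, Integrable (fun y => K (x - y) (a y))) :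
    ∫⁻ x in (Metric.ball 0 (c * R))ᶜ, (‖kconv K a x‖₊ : ℝ≥0∞) * ENNReal.ofReal (w x)
      ≤ ENNReal.ofReal C *
        ∫⁻ y in Metric.ball 0 R, (‖a y‖₊ : ℝ≥0∞) * ENNReal.ofReal (w y) := by
  set S : Set (EuclideanSpace ℝ (Fin n)) := (Metric.ball 0 (c * R))ᶜ
  have hKm : Measurable fun p : EuclideanSpace ℝ (Fin n) × EuclideanSpace ℝ (Fin n) =>
      (‖K (p.1 - p.2) - K p.1‖₊ : ℝ≥0∞) :=
    ((hK.comp_measurable (measurable_fst.sub measurable_snd)).sub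
      (hK.comp_measurable measurable_fst)).enorm
  have hpt (y : EuclideanSpace ℝ (Fin n)) :
      (∫⁻ x in S, (‖K (x - y) - K x‖₊ : ℝ≥0∞) * ENNReal.ofReal (w x)) * ‖a y‖₊
        ≤ (Metric.ball 0 R).indicator
          (fun y => ENNReal.ofReal C * ((‖a y‖₊ : ℝ≥0∞) * ENNReal.ofReal (w y))) y := by
    by_cases hy : y ∈ Metric.ball 0 R
    · rw [Set.indicator_of_mem hy]
      rcases eq_or_ne y 0 with rfl | hy0
      · simp
      have hsub : S ⊆ {x | ‖x‖ ≥ c * ‖y‖} := fun x hx => by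
        have hx' : c * R ≤ ‖x‖ := by simpa [S] using hx
        exact (mul_le_mul_of_nonneg_left (mem_ball_zero_iff.1 hy).le hc).trans hx'
      calc _ ≤ ENNReal.ofReal (C * w y) * ‖a y‖₊ :=
            mul_le_mul_left ((lintegral_mono_set hsub).trans (hK_smooth y hy0)) _
        _ = _ := by rw [ENNReal.ofReal_mul hC, mul_assoc, mul_comm (ENNReal.ofReal (w y))]
    · simp [hsupp y hy]
  calc ∫⁻ x in S, (‖kconv K a x‖₊ : ℝ≥0∞) * ENNReal.ofReal (w x)
      ≤ ∫⁻ x in S, ∫⁻ y,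
          (‖K (x - y) - K x‖₊ : ℝ≥0∞) * ‖a y‖₊ * ENNReal.ofReal (w x) := by
        refine lintegral_mono_ae ?_
        filter_upwards [ae_restrict_of_ae hconv] with x hx
        rw [lintegral_mul_const' _ _ ENNReal.ofReal_ne_top]
        exact mul_le_mul_left (enorm_kconv_le_of_integral_eq_zero ha ha0 hx) _
    _ = ∫⁻ y, ∫⁻ x in S,
          (‖K (x - y) - K x‖₊ : ℝ≥0∞) * ‖a y‖₊ * ENNReal.ofReal (w x) := by
        refine lintegral_lintegral_swap (Measurable.aemeasurable ?_)
        exact (hKm.mul (ham.comp_measurable measurable_snd).enorm).mul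
          (hw.comp measurable_fst).ennreal_ofReal
    _ = ∫⁻ y, (∫⁻ x in S, (‖K (x - y) - K x‖₊ : ℝ≥0∞) * ENNReal.ofReal (w x)) * ‖a y‖₊ := by
        refine lintegral_congr fun y => ?_
        rw [← lintegral_mul_const' _ _ ENNReal.coe_ne_top]
        exact lintegral_congr fun x => mul_right_comm _ _ _
    _ ≤ _ := lintegral_mono hpt
    _ = _ := by
        rw [lintegral_indicator Metric.isOpen_ball.measurableSet,
          lintegral_const_mul' _ _ ENNReal.ofReal_ne_top]

end Convolution

/-- If `w` is doubling with constant `D`, `c > 1`, `k = ⌈log₂ c⌉`, `K` satisfies the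
weighted smoothness condition with constant `C₃`, and `a` is a `w`-(1,2,0)-atom on a ball
`B(0,R)` centered at the origin with `K∗a` defined a.e. and
`‖K∗a‖_{L²_B(w)} ≤ C₁ ‖a‖_{L²_A(w)}`, then `‖K∗a‖_{L¹_B(w)} ≤ C₁ D^k + C₃`. -/
theorem atom_at_origin_L1_bound {n : ℕ} {A B : Type*}
    [NormedAddCommGroup A] [NormedSpace ℝ A] [CompleteSpace A]
    [NormedAddCommGroup B] [NormedSpace ℝ B] [CompleteSpace B]
    (w : EuclideanSpace ℝ (Fin n) → ℝ) (hw : IsWeight w)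
    (D : ℝ) (hD : IsDoubling w D)
    (c : ℝ) (hc : 1 < c) (k : ℕ) (hk : k = ⌈Real.logb 2 c⌉₊)
    (K : EuclideanSpace ℝ (Fin n) → (A →L[ℝ] B)) (hK : IsKernel K)
    (C₁ C₃ : ℝ) (hC₁ : 0 < C₁) (hC₃ : 0 < C₃)
    (hK_smooth : ∀ y : EuclideanSpace ℝ (Fin n), y ≠ 0 →
      (∫⁻ x in {x | ‖x‖ ≥ c * ‖y‖},
          (‖K (x - y) - K x‖₊ : ℝ≥0∞) * ENNReal.ofReal (w x))
        ≤ ENNReal.ofReal (C₃ * w y))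
    (R : ℝ) (hR : 0 < R)
    (a : EuclideanSpace ℝ (Fin n) → A)
    (ha : IsAtom1q0 w 2 (Metric.ball (0 : EuclideanSpace ℝ (Fin n)) R) a)
    (hconv : ∀ᵐ x ∂volume, Integrable (fun y => K (x - y) (a y)) volume)
    (hbdd : wLp 2 w (kconv K a) ≤ ENNReal.ofReal C₁ * wLp 2 w a) :
    wL1 w (kconv K a) ≤ ENNReal.ofReal (C₁ * D ^ k + C₃) := by
  obtain ⟨ham, hai, hsupp, -, ha0⟩ := id ha
  have hDk : (1 : ℝ≥0∞) ≤ ENNReal.ofReal D ^ k :=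
    one_le_pow₀ (ENNReal.one_le_ofReal.2 hD.1)
  have hck : c ≤ 2 ^ k := by
    rw [← Real.rpow_natCast, ← Real.logb_le_iff_le_rpow one_lt_two (by linarith), hk]
    exact Nat.le_ceil _
  set W := ∫⁻ y in Metric.ball (0 : EuclideanSpace ℝ (Fin n)) R, ENNReal.ofReal (w y)
  have hnorm : wLp 2 w a * W ^ (1 / 2 : ℝ) ≤ 1 := ha.wLp_two_mul_le_one hw hR
  have hball : ∫⁻ y in Metric.ball (0 : EuclideanSpace ℝ (Fin n)) (c * R), ENNReal.ofReal (w y)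
      ≤ ENNReal.ofReal D ^ k * W :=
    (lintegral_mono_set (Metric.ball_subset_ball (by gcongr))).trans
      (hD.lintegral_ball_two_pow_mul_le 0 hR k)
  have hnear : ∫⁻ x in Metric.ball 0 (c * R), (‖kconv K a x‖₊ : ℝ≥0∞) * ENNReal.ofReal (w x)
      ≤ ENNReal.ofReal C₁ * ENNReal.ofReal D ^ k :=
    calc _ ≤ wLp 2 w (kconv K a) * (∫⁻ x in Metric.ball 0 (c * R), ENNReal.ofReal (w x)) ^
            (1 / 2 : ℝ) :=
          setLIntegral_mul_weight_le_wLp_two hw.2.1 (stronglyMeasurable_kconv_s7 hK.1 ham) _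
      _ ≤ ENNReal.ofReal C₁ * wLp 2 w a * (ENNReal.ofReal D ^ k * W) ^ (1 / 2 : ℝ) := by gcongr
      _ = ENNReal.ofReal C₁ * (ENNReal.ofReal D ^ k) ^ (1 / 2 : ℝ) *
            (wLp 2 w a * W ^ (1 / 2 : ℝ)) := by
          rw [ENNReal.mul_rpow_of_nonneg _ _ (by norm_num)]; ring
      _ ≤ ENNReal.ofReal C₁ * (ENNReal.ofReal D ^ k) ^ (1 : ℝ) * 1 := by
          gcongr
          norm_num
      _ = _ := by rw [ENNReal.rpow_one, mul_one]
  have hfar : ∫⁻ x in (Metric.ball 0 (c * R))ᶜ,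
      (‖kconv K a x‖₊ : ℝ≥0∞) * ENNReal.ofReal (w x) ≤ ENNReal.ofReal C₃ :=
    calc _ ≤ ENNReal.ofReal C₃ *
          ∫⁻ y in Metric.ball 0 R, (‖a y‖₊ : ℝ≥0∞) * ENNReal.ofReal (w y) :=
          setLIntegral_compl_ball_kconv_le hw.2.1 hK.1 (by linarith) hC₃.le hK_smooth
            ham hai ha0 hsupp hconv
      _ ≤ ENNReal.ofReal C₃ * 1 := by
          gcongr
          exact (setLIntegral_mul_weight_le_wLp_two hw.2.1 ham _).trans hnorm
      _ = _ := mul_one _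
  have hD0 : 0 ≤ D := zero_le_one.trans hD.1
  rw [wL1, ← lintegral_add_compl _ (Metric.isOpen_ball (x := 0) (ε := c * R)).measurableSet,
    ENNReal.ofReal_add (by positivity) hC₃.le, ENNReal.ofReal_mul hC₁.le, ENNReal.ofReal_pow hD0]
  exact add_le_add hnear hfar
end
end
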